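/- Let B be an infinite complete ccc Boolean algebra of cardinality at most the continuum 𝔠. Then the following are equivalent: (i) every filter on B having a base of cardinality less than 𝔠 can be extended to a coherent selective ultrafilter on B; (ii) no family of fewer than 𝔠 meager subsets of the Baire space ℕ → ℕ covers the Baire space (equivalently, 𝔠 = cov(M)). -/

import Mathlib

open Cardinal Filter

variable {B : Type*}

/-- A partition of a Boolean algebra: a set of nonzero, pairwise disjoint
elements that is maximal (every nonzero element meets some member). -/
def IsBPartition [BooleanAlgebra B] (P : Set B) : Prop :=
  ⊥ ∉ P ∧ (P.Pairwise fun a b => a ⊓ b = ⊥) ∧ ∀ b : B, b ≠ ⊥ → ∃ p ∈ P, b ⊓ p ≠ ⊥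

/-- `P` refines `Q`: every member of `P` lies below some member of `Q`. -/
def BRefines [BooleanAlgebra B] (P Q : Set B) : Prop :=
  ∀ p ∈ P, ∃ q ∈ Q, p ≤ q

/-- A filter on a Boolean algebra. -/
def IsBFilter [BooleanAlgebra B] (F : Set B) : Prop :=
  ⊥ ∉ F ∧ ⊤ ∈ F ∧ (∀ a ∈ F, ∀ b : B, a ≤ b → b ∈ F) ∧ ∀ a ∈ F, ∀ b ∈ F, a ⊓ b ∈ F

/-- An ultrafilter on a Boolean algebra. -/
def IsBUltrafilter [BooleanAlgebra B] (U : Set B) : Prop :=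
  IsBFilter U ∧ ∀ b : B, b ∈ U ∨ bᶜ ∈ U

/-- The countable chain condition: every set of pairwise disjoint
nonzero elements is countable. -/
def BCCC (B : Type*) [BooleanAlgebra B] : Prop :=
  ∀ S : Set B, ⊥ ∉ S → (S.Pairwise fun a b => a ⊓ b = ⊥) → S.Countable

/-- A filter on ℕ, presented as a family of subsets of ℕ. -/
def IsNFilter (V : Set (Set ℕ)) : Prop :=
  ∅ ∉ V ∧ Set.univ ∈ V ∧ (∀ A ∈ V, ∀ C : Set ℕ, A ⊆ C → C ∈ V) ∧
    ∀ A ∈ V, ∀ C ∈ V, A ∩ C ∈ V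

/-- An ultrafilter on ℕ, presented as a family of subsets of ℕ. -/
def IsNUltrafilter (V : Set (Set ℕ)) : Prop :=
  IsNFilter V ∧ ∀ A : Set ℕ, A ∈ V ∨ Aᶜ ∈ V

/-- A P-point on ℕ: an ultrafilter such that for every partition of ℕ into
sets not in the ultrafilter there is a member meeting each piece finitely. -/
def IsPPointFamily (V : Set (Set ℕ)) : Prop :=
  IsNUltrafilter V ∧ ∀ A : ℕ → Set ℕ, (Pairwise fun m n => A m ∩ A n = ∅) →
    (⋃ n, A n) = Set.univ → (∀ n, A n ∉ V) → ∃ S ∈ V, ∀ n, (S ∩ A n).Finite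

/-- A selective ultrafilter on ℕ: for every partition of ℕ into sets not in
the ultrafilter there is a member meeting each piece in at most one point. -/
def IsSelectiveFamily (V : Set (Set ℕ)) : Prop :=
  IsNUltrafilter V ∧ ∀ A : ℕ → Set ℕ, (Pairwise fun m n => A m ∩ A n = ∅) →
    (⋃ n, A n) = Set.univ → (∀ n, A n ∉ V) → ∃ S ∈ V, ∀ n, (S ∩ A n).Subsingleton

/-- A coherent P-ultrafilter: an ultrafilter whose trace on every countably
infinite partition is a P-point on ℕ. -/
def IsCoherentPUltrafilter [CompleteBooleanAlgebra B] (U : Set B) : Prop :=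
  IsBUltrafilter U ∧ ∀ p : ℕ → B, Function.Injective p → IsBPartition (Set.range p) →
    IsPPointFamily {A : Set ℕ | (⨆ n ∈ A, p n) ∈ U}

/-- A coherent selective ultrafilter: an ultrafilter whose trace on every
countably infinite partition is a selective ultrafilter on ℕ. -/
def IsCoherentSelectiveUltrafilter [CompleteBooleanAlgebra B] (U : Set B) : Prop :=
  IsBUltrafilter U ∧ ∀ p : ℕ → B, Function.Injective p → IsBPartition (Set.range p) →
    IsSelectiveFamily {A : Set ℕ | (⨆ n ∈ A, p n) ∈ U}

/-- Atomless: every nonzero element properly contains a nonzero element. -/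
def BAtomless (B : Type*) [BooleanAlgebra B] : Prop :=
  ∀ b : B, b ≠ ⊥ → ∃ c : B, c ≠ ⊥ ∧ c < b

/-- The finite intersection property for a subset of a Boolean algebra. -/
def BFIP [BooleanAlgebra B] (D : Set B) : Prop :=
  ∀ s : Finset B, ↑s ⊆ D → s.inf id ≠ ⊥

theorem BFIP.insert_of_inf_ne [BooleanAlgebra B] {D : Set B} {x : B}
    (h : ∀ s : Finset B, ↑s ⊆ D → x ⊓ s.inf id ≠ ⊥) : BFIP (insert x D) := by
  classical
  intro s hs hbot
  refine h (s.erase x) ?_ ?_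
  · intro y hy
    rw [Finset.coe_erase] at hy
    exact (hs hy.1).resolve_left hy.2
  · have h' := Finset.inf_mono (f := id) (Finset.insert_erase_subset x s)
    rw [hbot, Finset.inf_insert] at h'
    exact le_bot_iff.1 h'

theorem BFIP.exists_of_not_insert [BooleanAlgebra B] {D : Set B} {x : B}
    (h : ¬BFIP (insert x D)) : ∃ s : Finset B, ↑s ⊆ D ∧ x ⊓ s.inf id = ⊥ := by
  by_contra! h'
  exact h (BFIP.insert_of_inf_ne h')

theorem IsBFilter.inf_mem [BooleanAlgebra B] {F : Set B} (hF : IsBFilter F) (s : Finset B)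
    (hs : ↑s ⊆ F) : s.inf id ∈ F := by
  classical
  induction s using Finset.induction_on with
  | empty => simpa using hF.2.1
  | insert a s _ ih =>
    rw [Finset.coe_insert, Set.insert_subset_iff] at hs
    rw [Finset.inf_insert]
    exact hF.2.2.2 _ hs.1 _ (ih hs.2)

theorem BFIP.exists_ultrafilter [BooleanAlgebra B] {D : Set B} (hD : BFIP D) :
    ∃ U : Set B, IsBUltrafilter U ∧ D ⊆ U := by
  classical
  let F : Order.PFilter B := Order.IsPFilter.toPFilter
    (F := {b | ∃ s : Finset B, ↑s ⊆ D ∧ s.inf id ≤ b}) <| by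
    refine Order.IsPFilter.of_def ⟨⊤, ∅, by simp, le_top⟩ ?_ ?_
    · rintro a ⟨s, hs, hsa⟩ b ⟨t, ht, htb⟩
      refine ⟨(s ∪ t).inf id, ⟨s ∪ t, by simp [hs, ht], le_rfl⟩, ?_, ?_⟩
      · exact (Finset.inf_mono Finset.subset_union_left).trans hsa
      · exact (Finset.inf_mono Finset.subset_union_right).trans htb
    · rintro x y hxy ⟨s, hs, hsx⟩
      exact ⟨s, hs, hsx.trans hxy⟩
  have hF : ∀ b, b ∈ F ↔ ∃ s : Finset B, ↑s ⊆ D ∧ s.inf id ≤ b := fun b => Iff.rfl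
  obtain ⟨J, hJ, -, hFJ⟩ := DistribLattice.prime_ideal_of_disjoint_filter_ideal
    (F := F) (I := Order.Ideal.principal ⊥) <| by
      rw [Set.disjoint_left]
      rintro b hb hb'
      obtain ⟨s, hs, hsb⟩ := (hF b).1 hb
      have : b = ⊥ := le_bot_iff.1 (Order.Ideal.mem_principal.1 hb')
      exact hD s hs (le_bot_iff.1 (this ▸ hsb))
  rw [Set.disjoint_left] at hFJ
  have htop : (⊤ : B) ∉ J := hJ.toIsProper.top_notMem
  refine ⟨{b | b ∉ J}, ⟨⟨by simp, htop, fun a ha b hab hb => ha (J.lower hab hb),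
    fun a ha b hb hab => (hJ.mem_or_mem hab).elim ha hb⟩, fun b => ?_⟩, fun b hb => ?_⟩
  · by_contra! h
    simp only [Set.mem_ofPred_eq, not_not] at h
    exact htop (sup_compl_eq_top (x := b) ▸ Order.Ideal.sup_mem h.1 h.2)
  · exact hFJ ((hF b).2 ⟨{b}, by simpa using hb, by simp⟩)

/-- A transfinite recursion that preserves the finite intersection property: if every small set
with the property can be enlarged by an element that is good for a given index, then every small
set with the property can be enlarged by elements that are good for all indices. -/
theorem BFIP.exists_good_extension.{u} {B : Type u} [BooleanAlgebra B] {I : Type u}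
    {κ : Cardinal.{u}} (hκ : ℵ₀ ≤ κ) (hI : #I ≤ κ) (good : I → B → Prop)
    (step : ∀ D : Set B, BFIP D → #D < κ → ∀ i, ∃ x, good i x ∧ BFIP (insert x D))
    {C : Set B} (hC : BFIP C) (hCκ : #C < κ) :
    ∃ E : Set B, C ⊆ E ∧ BFIP E ∧ ∀ i, ∃ x ∈ E, good i x := by
  classical
  let T := (#I).ord.ToType
  obtain ⟨e⟩ : Nonempty (T ≃ I) := Cardinal.eq.1 (mk_ord_toType _)
  let next : T → Set B → B := fun i D =>
    if h : ∃ x, good (e i) x ∧ BFIP (insert x D) then h.choose else ⊤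
  let g : T → B := WellFounded.fix (wellFounded_lt (α := T)) fun i ih =>
    next i (C ∪ Set.range fun j : Set.Iio i => ih j j.2)
  have hg : ∀ i, g i = next i (C ∪ g '' Set.Iio i) := by
    intro i
    rw [Set.image_eq_range]
    exact WellFounded.fix_eq _ _ i
  have hlim : ∀ L : Set T, (∀ m ∈ L, Set.Iio m ⊆ L ∧ BFIP (insert (g m) (C ∪ g '' Set.Iio m))) →
      BFIP (C ∪ g '' L) := by
    intro L hL s hs
    have hfin : ∃ t : Finset T, ↑t ⊆ L ∧ ↑s ⊆ C ∪ g '' t := by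
      have h1 : ((s : Set B) \ C) ⊆ g '' L := fun x hx => (hs hx.1).resolve_left hx.2
      have h2 : (↑(s.filter (· ∉ C)) : Set B) ⊆ g '' L := by
        intro x hx
        rw [Finset.mem_coe, Finset.mem_filter] at hx
        exact h1 ⟨hx.1, hx.2⟩
      obtain ⟨t, htL, hts⟩ := Finset.subset_set_image_iff.1 h2
      refine ⟨t, htL, fun x hx => or_iff_not_imp_left.2 fun hxC => ?_⟩
      rw [← Finset.coe_image, hts]
      simpa using ⟨hx, hxC⟩
    obtain ⟨t, htL, hst⟩ := hfin
    rcases t.eq_empty_or_nonempty with rfl | hne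
    · exact hC s (by simpa using hst)
    · have hm := t.max'_mem hne
      refine (hL _ (htL hm)).2 s (hst.trans ?_)
      rintro x (hx | ⟨j, hj, rfl⟩)
      · exact Or.inr (Or.inl hx)
      · rcases (t.le_max' j hj).eq_or_lt with h | h
        · exact Or.inl (by rw [h])
        · exact Or.inr (Or.inr ⟨j, h, rfl⟩)
  have hsmall : ∀ i : T, #(C ∪ g '' Set.Iio i : Set B) < κ := by
    intro i
    refine (mk_union_le _ _).trans_lt (add_lt_of_lt hκ hCκ (mk_image_le.trans_lt ?_))
    exact (mk_Iio_lt i (by simp [T])).trans_le (by simpa [T] using hI)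
  have hstep : ∀ i : T, BFIP (C ∪ g '' Set.Iio i) →
      good (e i) (g i) ∧ BFIP (insert (g i) (C ∪ g '' Set.Iio i)) := by
    intro i hi
    have h := step _ hi (hsmall i) (e i)
    have : g i = h.choose := by
      rw [hg i]
      exact dif_pos h
    rw [this]
    exact h.choose_spec
  have hall : ∀ i : T, BFIP (C ∪ g '' Set.Iio i) := by
    intro i
    induction i using WellFoundedLT.induction with
    | ind i ih =>
      exact hlim _ fun m hm => ⟨fun j (hj : j < m) => hj.trans hm, (hstep m (ih m hm)).2⟩
  refine ⟨C ∪ g '' Set.univ, Set.subset_union_left,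
    hlim _ fun m _ => ⟨Set.subset_univ _, (hstep m (hall m)).2⟩, fun i => ?_⟩
  refine ⟨g (e.symm i), Or.inr ⟨_, trivial, rfl⟩, ?_⟩
  simpa using (hstep (e.symm i) (hall _)).1

theorem exists_forall_mem_of_not_meagre_cover.{u}
    (hcov : ¬∃ 𝒮 : Set (Set (ℕ → ℕ)), #𝒮 < Cardinal.continuum ∧
      (∀ s ∈ 𝒮, IsMeagre s) ∧ ⋃₀ 𝒮 = Set.univ)
    {ι : Type u} (hι : #ι < Cardinal.continuum) (O : ι → Set (ℕ → ℕ))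
    (hO : ∀ i, IsOpen (O i)) (hd : ∀ i, Dense (O i)) : ∃ f, ∀ i, f ∈ O i := by
  by_contra! h
  refine hcov ⟨Set.range fun i => (O i)ᶜ, ?_, ?_, ?_⟩
  · have h1 := mk_range_le_lift (f := fun i => (O i)ᶜ)
    rw [lift_uzero] at h1
    exact lift_lt_continuum.1 (h1.trans_lt hι)
  · rintro _ ⟨i, rfl⟩
    rw [IsMeagre, compl_compl]
    exact residual_of_dense_open (hO i) (hd i)
  · refine Set.eq_univ_of_forall fun f => ?_
    obtain ⟨i, hi⟩ := h f
    exact ⟨_, ⟨i, rfl⟩, hi⟩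

theorem isOpen_dense_exists_mem {A : ℕ → Set ℕ} (hA : {n | (A n).Nonempty}.Infinite) :
    IsOpen {f : ℕ → ℕ | ∃ n, f n ∈ A n} ∧ Dense {f : ℕ → ℕ | ∃ n, f n ∈ A n} := by
  constructor
  · rw [Set.ofPred_exists]
    exact isOpen_iUnion fun n => (isOpen_discrete (A n)).preimage (continuous_apply n)
  · intro f
    classical
    let k : ℕ → ℕ := fun n => if h : (A n).Nonempty then h.some else 0
    refine mem_closure_of_frequently_of_tendsto (f := fun n => Function.update f n (k n))
      (b := atTop) ?_ ?_
    · refine (Nat.frequently_atTop_iff_infinite.2 hA).mono fun n hn => ⟨n, ?_⟩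
      have : (A n).Nonempty := hn
      simpa [k, this] using this.some_mem
    · rw [tendsto_pi_nhds]
      intro i
      refine tendsto_const_nhds.congr' ?_
      filter_upwards [eventually_gt_atTop i] with n hn
      rw [Function.update_of_ne hn.ne]

theorem mk_finset_lt_continuum.{u} {α : Type u} (h : #α < Cardinal.continuum) :
    #(Finset α) < Cardinal.continuum := by
  cases finite_or_infinite α
  · exact (lt_aleph0_of_finite _).trans aleph0_lt_continuum
  · rwa [mk_finset_of_infinite]

theorem IsBPartition.iSup_eq_top [CompleteBooleanAlgebra B] {p : ℕ → B}
    (hp : IsBPartition (Set.range p)) : ⨆ n, p n = ⊤ := by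
  by_contra h
  obtain ⟨_, ⟨n, rfl⟩, hn⟩ := hp.2.2 (⨆ n, p n)ᶜ (by simpa using h)
  exact hn ((disjoint_compl_left.mono_right (le_iSup p n)).eq_bot)

theorem BFIP.exists_insert_iSup [CompleteBooleanAlgebra B]
    (hcov : ¬∃ 𝒮 : Set (Set (ℕ → ℕ)), #𝒮 < Cardinal.continuum ∧
      (∀ s ∈ 𝒮, IsMeagre s) ∧ ⋃₀ 𝒮 = Set.univ)
    {D : Set B} (hD : BFIP D) (hDc : #D < Cardinal.continuum) {p : ℕ → B}
    (hp : ⨆ n, p n = ⊤) {A : ℕ → Set ℕ} (hA : Pairwise fun m n => A m ∩ A n = ∅)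
    (hU : ⋃ n, A n = Set.univ) :
    ∃ x, ((∃ n, x = ⨆ k ∈ A n, p k) ∨
      ∃ S : Set ℕ, (∀ n, (S ∩ A n).Subsingleton) ∧ x = ⨆ k ∈ S, p k) ∧ BFIP (insert x D) := by
  classical
  by_cases h : ∃ n, BFIP (insert (⨆ k ∈ A n, p k) D)
  · obtain ⟨n, hn⟩ := h
    exact ⟨_, Or.inl ⟨n, rfl⟩, hn⟩
  push Not at h
  choose s hsD hs using fun n => BFIP.exists_of_not_insert (h n)
  have hinf : ∀ t : Finset B, ↑t ⊆ D →
      {n | {k | k ∈ A n ∧ p k ⊓ t.inf id ≠ ⊥}.Nonempty}.Infinite := by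
    intro t ht hfin
    let u := t ∪ hfin.toFinset.biUnion s
    have huD : ↑u ⊆ D := by
      simp only [u, Finset.coe_union, Finset.coe_biUnion, Set.union_subset_iff,
        Set.iUnion_subset_iff]
      exact ⟨ht, fun n _ => hsD n⟩
    refine hD u huD (eq_bot_iff.2 ?_)
    rw [← inf_top_eq (u.inf id), ← hp, inf_iSup_eq]
    refine iSup_le fun k => ?_
    obtain ⟨n, hn⟩ := Set.mem_iUnion.1 (hU ▸ Set.mem_univ k)
    by_cases hk : p k ⊓ t.inf id = ⊥
    · rw [← hk, inf_comm]
      exact inf_le_inf_left _ (Finset.inf_mono Finset.subset_union_left)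
    · have hmem : n ∈ hfin.toFinset := by
        rw [Set.Finite.mem_toFinset]
        exact ⟨k, hn, hk⟩
      rw [← hs n, inf_comm]
      refine inf_le_inf (le_iSup₂_of_le k hn le_rfl) (Finset.inf_mono ?_)
      exact (Finset.subset_biUnion_of_mem s hmem).trans Finset.subset_union_right
  obtain ⟨f, hf⟩ := exists_forall_mem_of_not_meagre_cover hcov (mk_finset_lt_continuum hDc)
    (fun t : Finset D => {f : ℕ → ℕ | ∃ n, f n ∈ {k | k ∈ A n ∧
      p k ⊓ (t.map (Function.Embedding.subtype _)).inf id ≠ ⊥}})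
    (fun t => (isOpen_dense_exists_mem (hinf _ (by simp))).1)
    (fun t => (isOpen_dense_exists_mem (hinf _ (by simp))).2)
  refine ⟨_, Or.inr ⟨{k | ∃ n, k ∈ A n ∧ f n = k}, ?_, rfl⟩, ?_⟩
  · have huniq : ∀ m n k, k ∈ A m → k ∈ A n → m = n := by
      intro m n k hm hn
      by_contra hne
      exact (hA hne).le ⟨hm, hn⟩
    rintro n k ⟨⟨m, hm, hk⟩, hkn⟩ k' ⟨⟨m', hm', hk'⟩, hkn'⟩
    rw [← hk, ← hk', huniq _ _ _ hm hkn, huniq _ _ _ hm' hkn']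
  · refine BFIP.insert_of_inf_ne fun t ht hbot => ?_
    obtain ⟨n, hn, hne⟩ := hf (t.subtype (· ∈ D))
    rw [Finset.subtype_map_of_mem ht] at hne
    refine hne (eq_bot_iff.2 (hbot ▸ inf_le_inf_right _ ?_))
    exact le_iSup₂_of_le (f := fun k (_ : k ∈ {k | ∃ n, k ∈ A n ∧ f n = k}) => p k)
      (f n) ⟨n, hn, rfl⟩ le_rfl

theorem IsBUltrafilter.trace [CompleteBooleanAlgebra B] {U : Set B} (hU : IsBUltrafilter U)
    {p : ℕ → B} (hinj : Function.Injective p) (hp : IsBPartition (Set.range p)) :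
    IsNUltrafilter {A : Set ℕ | (⨆ n ∈ A, p n) ∈ U} := by
  obtain ⟨⟨hbot, htop, hup, hinf⟩, hult⟩ := hU
  refine ⟨⟨by simpa using hbot, by simpa [hp.iSup_eq_top] using htop,
    fun A hA C hAC => hup _ hA _ (biSup_mono fun _ h => hAC h), fun A hA C hC => ?_⟩, fun A => ?_⟩
  · refine hup _ (hinf _ hA _ hC) _ ?_
    rw [biSup_inf_biSup]
    refine iSup₂_le fun q hq => ?_
    by_cases h : q.1 = q.2
    · have h2 : q.1 ∈ C := h ▸ hq.2
      exact inf_le_left.trans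
        (le_iSup₂_of_le (f := fun n (_ : n ∈ A ∩ C) => p n) q.1 ⟨hq.1, h2⟩ le_rfl)
    · rw [hp.2.1 ⟨_, rfl⟩ ⟨_, rfl⟩ (hinj.ne h)]
      exact bot_le
  · refine (hult (⨆ n ∈ A, p n)).imp_right fun h => hup _ h _ ?_
    rw [compl_le_iff_compl_le, ← codisjoint_iff_compl_le_left, codisjoint_iff, eq_top_iff,
      ← hp.iSup_eq_top]
    refine iSup_le fun n => ?_
    by_cases hn : n ∈ A
    · exact le_sup_of_le_left (le_iSup₂_of_le n hn le_rfl)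
    · exact le_sup_of_le_right (le_iSup₂_of_le (f := fun n (_ : n ∈ Aᶜ) => p n) n hn le_rfl)

theorem exists_coherentSelective_of_not_meagre_cover [CompleteBooleanAlgebra B]
    (hcard : #B ≤ Cardinal.continuum)
    (hcov : ¬∃ 𝒮 : Set (Set (ℕ → ℕ)), #𝒮 < Cardinal.continuum ∧
      (∀ s ∈ 𝒮, IsMeagre s) ∧ ⋃₀ 𝒮 = Set.univ)
    {C : Set B} (hC : BFIP C) (hCc : #C < Cardinal.continuum) :
    ∃ U : Set B, IsCoherentSelectiveUltrafilter U ∧ C ⊆ U := by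
  have hI : #((ℕ → B) × (ℕ → Set ℕ)) ≤ Cardinal.continuum := by
    have h1 : #(ℕ → B) ≤ Cardinal.continuum := by
      rw [mk_arrow, lift_uzero, mk_nat, lift_aleph0, ← continuum_power_aleph0]
      exact power_le_power_right hcard
    have h2 : #(ℕ → Set ℕ) = Cardinal.continuum := by simp
    rw [mk_prod, h2, lift_continuum, lift_uzero]
    exact mul_le_of_le aleph0_le_continuum h1 le_rfl
  obtain ⟨E, hCE, hE, hgood⟩ := BFIP.exists_good_extension aleph0_le_continuum hI
    (fun i x => Pairwise (fun m n => i.2 m ∩ i.2 n = ∅) → ⋃ n, i.2 n = Set.univ →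
      ⨆ n, i.1 n = ⊤ → (∃ n, x = ⨆ k ∈ i.2 n, i.1 k) ∨
        ∃ S : Set ℕ, (∀ n, (S ∩ i.2 n).Subsingleton) ∧ x = ⨆ k ∈ S, i.1 k)
    (fun D hD hDc i => by
      by_cases h : Pairwise (fun m n => i.2 m ∩ i.2 n = ∅) ∧ ⋃ n, i.2 n = Set.univ ∧
        ⨆ n, i.1 n = ⊤
      · obtain ⟨x, hx, hx'⟩ := hD.exists_insert_iSup hcov hDc h.2.2 h.1 h.2.1
        exact ⟨x, fun _ _ _ => hx, hx'⟩
      · refine ⟨⊤, fun h1 h2 h3 => (h ⟨h1, h2, h3⟩).elim, BFIP.insert_of_inf_ne fun s hs => ?_⟩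
        rw [top_inf_eq]
        exact hD s hs) hC hCc
  obtain ⟨U, hU, hEU⟩ := hE.exists_ultrafilter
  refine ⟨U, ⟨hU, fun p hinj hp => ⟨hU.trace hinj hp, fun A hA hAU hAn => ?_⟩⟩, hCE.trans hEU⟩
  obtain ⟨x, hxE, hx⟩ := hgood (p, A)
  rcases hx hA hAU hp.iSup_eq_top with ⟨n, rfl⟩ | ⟨S, hS, rfl⟩
  · exact (hAn n (hEU hxE)).elim
  · exact ⟨S, hEU hxE, hS⟩

theorem exists_infinite_Iic_lt [BooleanAlgebra B] {b : B} (hb : (Set.Iic b).Infinite) :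
    ∃ c < b, (Set.Iic c).Infinite := by
  obtain ⟨d, ⟨hdb, hd⟩⟩ := (hb.sdiff ((Set.finite_singleton b).insert ⊥)).nonempty
  simp only [Set.mem_insert_iff, Set.mem_singleton_iff, not_or] at hd
  by_cases hdi : (Set.Iic d).Infinite
  · exact ⟨d, lt_of_le_of_ne hdb hd.2, hdi⟩
  refine ⟨b \ d, sdiff_lt hdb hd.1, fun hfin => hb ?_⟩
  refine ((Set.not_infinite.1 hdi).image2 (· ⊔ ·) hfin).subset fun x hx => ?_
  exact ⟨x ⊓ d, inf_le_right, x \ d, sdiff_le_sdiff_right hx, sup_inf_sdiff x d⟩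

theorem exists_isBPartition_range [CompleteBooleanAlgebra B] [Infinite B] :
    ∃ p : ℕ → B, Function.Injective p ∧ IsBPartition (Set.range p) := by
  choose next hlt hinf using fun b : {b : B // (Set.Iic b).Infinite} => exists_infinite_Iic_lt b.2
  let b : ℕ → {b : B // (Set.Iic b).Infinite} := fun n =>
    Nat.rec ⟨⊤, by simpa using Set.infinite_univ⟩ (fun _ c => ⟨next c, hinf c⟩) n
  have hb : ∀ n, (b (n + 1)).1 < (b n).1 := fun n => hlt (b n)
  have hanti : Antitone fun n => (b n).1 := antitone_nat_of_succ_le fun n => (hb n).le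
  let d : ℕ → B := fun n => (b n).1 \ (b (n + 1)).1
  have hd0 : ∀ n, d n ≠ ⊥ := fun n h => (hb n).not_ge (sdiff_eq_bot_iff.1 h)
  have hdd' : ∀ m n, m < n → Disjoint (d m) (d n) := fun m n h =>
    disjoint_sdiff_self_left.mono_right (sdiff_le.trans (hanti h))
  let p : ℕ → B := fun n => if n = 0 then (⨆ k, d (k + 1))ᶜ else d n
  have hpos : ∀ n, n ≠ 0 → p n = d n := fun n h => if_neg h
  have hzero : p 0 = (⨆ k, d (k + 1))ᶜ := rfl
  have hlt : ∀ m n, m < n → Disjoint (p m) (p n) := by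
    intro m n h
    rw [hpos n (by lia)]
    rcases Nat.eq_zero_or_pos m with rfl | hm
    · obtain ⟨n, rfl⟩ := Nat.exists_eq_add_of_lt h
      rw [hzero]
      refine disjoint_compl_left.mono_right ?_
      simpa using le_iSup (fun k => d (k + 1)) n
    · rw [hpos m hm.ne']
      exact hdd' m n h
  have hdisj : ∀ m n, m ≠ n → Disjoint (p m) (p n) := fun m n h =>
    h.lt_or_gt.elim (hlt m n) fun h => (hlt n m h).symm
  have hne : ∀ n, p n ≠ ⊥ := by
    intro n
    rcases Nat.eq_zero_or_pos n with rfl | hn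
    · rw [hzero]
      refine fun h => hd0 0 (eq_bot_iff.2 (h ▸ le_compl_iff_disjoint_right.2 ?_))
      exact disjoint_iSup_iff.2 fun k => hdd' _ _ k.succ_pos
    · rw [hpos n hn.ne']
      exact hd0 n
  refine ⟨p, fun m n h => ?_, ?_, ?_, fun a ha => ?_⟩
  · by_contra hmn
    have := hdisj m n hmn
    rw [← h, disjoint_self] at this
    exact hne m this
  · rintro ⟨n, hn⟩
    exact hne n hn
  · rintro _ ⟨m, rfl⟩ _ ⟨n, rfl⟩ h
    exact (hdisj m n fun h' => h (congrArg p h')).eq_bot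
  · by_contra! h
    refine ha ?_
    have h0 : a ≤ p 0 := by
      rw [hzero, le_compl_iff_disjoint_right, disjoint_iSup_iff]
      intro k
      rw [← hpos (k + 1) k.succ_ne_zero, disjoint_iff]
      exact h _ ⟨_, rfl⟩
    rw [← h _ ⟨0, rfl⟩, inf_eq_left.2 h0]

theorem exists_selective_of_generic_existence.{u} {B : Type u} [CompleteBooleanAlgebra B]
    [Infinite B]
    (hgen : ∀ F : Set B, IsBFilter F →
      (∃ C ⊆ F, #C < Cardinal.continuum ∧ ∀ a ∈ F, ∃ c ∈ C, c ≤ a) →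
      ∃ U : Set B, IsCoherentSelectiveUltrafilter U ∧ F ⊆ U)
    {ι : Type} (hι : #ι < Cardinal.continuum) [Nonempty ι] (Y : ι → Set ℕ)
    (hne : ∀ i, (Y i).Nonempty) (hdir : ∀ i j, ∃ k, Y k ⊆ Y i ∩ Y j) :
    ∃ V, IsSelectiveFamily V ∧ ∀ i, Y i ∈ V := by
  obtain ⟨p, hinj, hp⟩ := exists_isBPartition_range (B := B)
  have hmono : ∀ {S T : Set ℕ}, S ⊆ T → ⨆ n ∈ S, p n ≤ ⨆ n ∈ T, p n :=
    fun h => biSup_mono fun _ hx => h hx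
  obtain ⟨U, hU, hFU⟩ := hgen {a | ∃ i, ⨆ n ∈ Y i, p n ≤ a} (by
      refine ⟨?_, ⟨Classical.arbitrary ι, le_top⟩, ?_, ?_⟩
      · rintro ⟨i, hi⟩
        obtain ⟨n, hn⟩ := hne i
        exact hp.1 ⟨n, le_bot_iff.1 ((le_iSup₂_of_le n hn le_rfl).trans hi)⟩
      · rintro a ⟨i, hi⟩ b hab
        exact ⟨i, hi.trans hab⟩
      · rintro a ⟨i, hi⟩ b ⟨j, hj⟩
        obtain ⟨k, hk⟩ := hdir i j
        rw [Set.subset_inter_iff] at hk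
        exact ⟨k, le_inf ((hmono hk.1).trans hi) ((hmono hk.2).trans hj)⟩) (by
      refine ⟨Set.range fun i => ⨆ n ∈ Y i, p n, ?_, ?_, ?_⟩
      · rintro _ ⟨i, rfl⟩
        exact ⟨i, le_rfl⟩
      · have h1 := mk_range_le_lift (f := fun i => ⨆ n ∈ Y i, p n)
        rw [lift_uzero] at h1
        exact h1.trans_lt (lift_lt_continuum.2 hι)
      · rintro a ⟨i, hi⟩
        exact ⟨_, ⟨i, rfl⟩, hi⟩)
  exact ⟨_, hU.2 p hinj hp, fun i => hFU ⟨i, le_rfl⟩⟩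

/-- The basic open subset of the Baire space determined by a finite initial segment. -/
def baireCylinder (s : List ℕ) : Set (ℕ → ℕ) :=
  {x | ∀ i < s.length, x i = s.getD i 0}

theorem isOpen_baireCylinder (s : List ℕ) : IsOpen (baireCylinder s) := by
  have : baireCylinder s = ⋂ i ∈ Set.Iio s.length, (fun x : ℕ → ℕ => x i) ⁻¹' {s.getD i 0} := by
    ext x
    simp [baireCylinder]
  rw [this]
  exact (Set.finite_Iio _).isOpen_biInter fun i _ =>
    (isOpen_discrete _).preimage (continuous_apply i)

theorem baireCylinder_append_subset (s t : List ℕ) : baireCylinder (s ++ t) ⊆ baireCylinder s := by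
  intro x hx i hi
  rw [hx i (by simp; lia), List.getD_append _ _ _ _ hi]

theorem exists_baireCylinder_append_subset {G : Set (ℕ → ℕ)} (hG : IsOpen G) (hd : Dense G)
    (s : List ℕ) : ∃ t, baireCylinder (s ++ t) ⊆ G := by
  obtain ⟨x, hxs, hxG⟩ := hd.inter_open_nonempty _ (isOpen_baireCylinder s)
    ⟨fun i => s.getD i 0, fun _ _ => rfl⟩
  obtain ⟨_, ⟨y, n, rfl⟩, hxy, hyG⟩ :=
    (PiNat.isTopologicalBasis_cylinders (fun _ : ℕ => ℕ)).exists_subset_of_mem_open hxG hG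
  refine ⟨List.ofFn fun i : Fin n => x (s.length + i), fun z hz => hyG fun i hi => ?_⟩
  rw [← hxy i hi]
  have hz' := hz i (by simp; lia)
  rcases lt_or_ge i s.length with h | h
  · rw [hz', hxs i h, List.getD_append _ _ _ _ h]
  · rw [hz', List.getD_append_right _ _ _ _ h, List.getD_eq_getElem _ _ (by simp; lia)]
    simp [h]

theorem exists_forall_baireCylinder_append_subset {G : Set (ℕ → ℕ)} (hG : IsOpen G)
    (hd : Dense G) (E : Finset (List ℕ)) : ∃ t, ∀ s ∈ E, baireCylinder (s ++ t) ⊆ G := by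
  classical
  induction E using Finset.induction_on with
  | empty => exact ⟨[], by simp⟩
  | insert s E _ ih =>
    obtain ⟨t, ht⟩ := ih
    obtain ⟨u, hu⟩ := exists_baireCylinder_append_subset hG hd (s ++ t)
    refine ⟨t ++ u, fun r hr => ?_⟩
    rw [← List.append_assoc]
    rcases Finset.mem_insert.1 hr with rfl | hr
    · exact hu
    · exact (baireCylinder_append_subset _ _).trans (ht r hr)

theorem exists_mem_iInter_baireCylinder {L : ℕ → List ℕ} (hL : ∀ n, L n <+: L (n + 1)) :
    ∃ x, ∀ n, x ∈ baireCylinder (L n) := by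
  classical
  have hmono : ∀ m n, m ≤ n → L m <+: L n := fun m n h =>
    Nat.le_induction (List.prefix_refl _) (fun n _ ih => ih.trans (hL n)) n h
  have hval : ∀ m n i, m ≤ n → i < (L m).length → (L n).getD i 0 = (L m).getD i 0 := by
    intro m n i h hi
    obtain ⟨t, ht⟩ := hmono m n h
    rw [← ht, List.getD_append _ _ _ _ hi]
  refine ⟨fun i => if h : ∃ n, i < (L n).length then (L h.choose).getD i 0 else 0,
    fun n i hi => ?_⟩
  have h : ∃ n, i < (L n).length := ⟨n, hi⟩
  simp only [dif_pos h]
  rcases le_total n h.choose with hle | hle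
  · exact hval _ _ _ hle hi
  · exact (hval _ _ _ hle h.choose_spec).symm

theorem IsMeagre.exists_seq_open_dense {M : Set (ℕ → ℕ)} (hM : IsMeagre M) :
    ∃ O : ℕ → Set (ℕ → ℕ), (∀ n, IsOpen (O n)) ∧ (∀ n, Dense (O n)) ∧ ∀ x ∈ M, ∃ n, x ∉ O n := by
  obtain ⟨S, hSo, hSd, hSc, hSM⟩ := mem_residual_iff.1 hM
  obtain ⟨O, hO⟩ := (hSc.insert Set.univ).exists_eq_range (Set.insert_nonempty _ _)
  have hmem : ∀ n, O n = Set.univ ∨ O n ∈ S := fun n => by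
    have : O n ∈ insert Set.univ S := hO ▸ ⟨n, rfl⟩
    exact this
  refine ⟨O, fun n => ?_, fun n => ?_, fun x hx => ?_⟩
  · rcases hmem n with h | h
    · rw [h]
      exact isOpen_univ
    · exact hSo _ h
  · rcases hmem n with h | h
    · rw [h]
      exact dense_univ
    · exact hSd _ h
  · by_contra! h
    refine hSM (fun t ht => ?_) hx
    obtain ⟨n, rfl⟩ : t ∈ Set.range O := hO ▸ Or.inr ht
    exact h n

/-- For every function on the naturals there is a labelling of the naturals by consecutive finite
intervals such that numbers from intervals that are not adjacent are far apart. -/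
theorem exists_interval_labelling (c : ℕ → ℕ) (hc : Monotone c) :
    ∃ (m κ : ℕ → ℕ), (∀ n, n < m (κ n)) ∧ Monotone κ ∧
      ∀ a b, κ a + 2 ≤ κ b → c a < b := by
  obtain ⟨m, hm0, hm⟩ : ∃ m : ℕ → ℕ, m 0 = 0 ∧ ∀ k, m (k + 1) = m k + c (m k) + 1 :=
    ⟨fun n => Nat.rec 0 (fun _ r => r + c r + 1) n, rfl, fun _ => rfl⟩
  have hmono : StrictMono m := strictMono_nat_of_lt_succ fun k => by rw [hm]; lia
  let κ : ℕ → ℕ := fun n => Nat.findGreatest (fun k => m k ≤ n) n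
  have h1 : ∀ n, m (κ n) ≤ n := fun n =>
    Nat.findGreatest_spec (P := fun k => m k ≤ n) (Nat.zero_le n) (hm0.trans_le (Nat.zero_le n))
  have hle : ∀ k n, m k ≤ n → k ≤ κ n := fun k n h => by
    exact Nat.le_findGreatest (hmono.le_apply.trans h) h
  have h2 : ∀ n, n < m (κ n + 1) := fun n => by
    by_contra! h
    exact absurd (hle _ _ h) (by lia)
  refine ⟨fun k => m (k + 1), κ, h2, fun a b h => hle _ _ ((h1 a).trans h), fun a b h => ?_⟩
  calc c a ≤ c (m (κ a + 1)) := hc (h2 a).le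
    _ < m (κ a + 2) := by rw [hm (κ a + 1)]; lia
    _ ≤ m (κ b) := hmono.monotone h
    _ ≤ b := h1 b

/-- Finite concatenations, in order, of members of a sequence of lists with index below `n`. -/
def subConcats (t : ℕ → List ℕ) : ℕ → Finset (List ℕ)
  | 0 => {[]}
  | n + 1 => subConcats t n ∪ (subConcats t n).image (· ++ t n)

/-- The concatenation, in order, of the members of a sequence of lists with index in `S`
below `n`. -/
noncomputable def concatOn (t : ℕ → List ℕ) (S : Set ℕ) : ℕ → List ℕ
  | 0 => []
  | n + 1 => open Classical in if n ∈ S then concatOn t S n ++ t n else concatOn t S n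

theorem concatOn_succ_of_mem (t : ℕ → List ℕ) {S : Set ℕ} {n : ℕ} (h : n ∈ S) :
    concatOn t S (n + 1) = concatOn t S n ++ t n := by
  rw [concatOn, if_pos h]

theorem concatOn_succ_of_notMem (t : ℕ → List ℕ) {S : Set ℕ} {n : ℕ} (h : n ∉ S) :
    concatOn t S (n + 1) = concatOn t S n := by
  rw [concatOn, if_neg h]

theorem concatOn_prefix_succ (t : ℕ → List ℕ) (S : Set ℕ) (n : ℕ) :
    concatOn t S n <+: concatOn t S (n + 1) := by
  by_cases h : n ∈ S
  · rw [concatOn_succ_of_mem t h]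
    exact List.prefix_append _ _
  · rw [concatOn_succ_of_notMem t h]

theorem concatOn_mem_subConcats (t : ℕ → List ℕ) (S : Set ℕ) (n : ℕ) :
    concatOn t S n ∈ subConcats t n := by
  induction n with
  | zero => simp [concatOn, subConcats]
  | succ n ih =>
    rw [subConcats, Finset.mem_union]
    by_cases h : n ∈ S
    · rw [concatOn_succ_of_mem t h]
      exact Or.inr (Finset.mem_image_of_mem _ ih)
    · rw [concatOn_succ_of_notMem t h]
      exact Or.inl ih

theorem concatOn_eq_nil_or (t : ℕ → List ℕ) (S : Set ℕ) (n : ℕ) :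
    concatOn t S n = [] ∨ ∃ a ∈ S, a < n ∧ concatOn t S n = concatOn t S (a + 1) := by
  induction n with
  | zero => exact Or.inl rfl
  | succ n ih =>
    by_cases h : n ∈ S
    · exact Or.inr ⟨n, h, n.lt_succ_self, rfl⟩
    · rw [concatOn_succ_of_notMem t h]
      exact ih.imp_right fun ⟨a, ha, han, h⟩ => ⟨a, ha, han.trans n.lt_succ_self, h⟩

theorem IsSelectiveFamily.exists_selector {V : Set (Set ℕ)} (hV : IsSelectiveFamily V)
    (f : ℕ → ℕ) (hf : ∀ k, {j | f j = k} ∉ V) : ∃ S ∈ V, Set.InjOn f S := by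
  obtain ⟨S, hS, h⟩ := hV.2 (fun k => {j | f j = k})
    (fun k l hkl => by
      ext j
      simp only [Set.mem_inter_iff, Set.mem_ofPred_eq, Set.mem_empty_iff_false, iff_false, not_and]
      rintro rfl
      exact hkl) (by ext; simp) hf
  exact ⟨S, hS, fun a ha b hb hab => h (f b) ⟨ha, hab⟩ ⟨hb, rfl⟩⟩

theorem not_meagre_cover_of_exists_selective
    (hsel : ∀ {ι : Type} (_ : #ι < Cardinal.continuum) [Nonempty ι] (Y : ι → Set ℕ),
      (∀ i, (Y i).Nonempty) → (∀ i j, ∃ k, Y k ⊆ Y i ∩ Y j) →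
      ∃ V, IsSelectiveFamily V ∧ ∀ i, Y i ∈ V) :
    ¬∃ 𝒮 : Set (Set (ℕ → ℕ)), #𝒮 < Cardinal.continuum ∧
      (∀ s ∈ 𝒮, IsMeagre s) ∧ ⋃₀ 𝒮 = Set.univ := by
  classical
  rintro ⟨𝒮, hcard, hmeagre, hcover⟩
  choose O hOo hOd hOM using fun M : 𝒮 => (hmeagre M M.2).exists_seq_open_dense
  let e : ℕ ≃ ℕ × List ℕ := (Denumerable.eqv _).symm
  let π : ℕ → ℕ := fun j => (e j).1
  let Y : Finset 𝒮 × ℕ → Set ℕ := fun i => {j | i.2 ≤ π j ∧ ∀ M ∈ i.1, ∀ k < π j, ∀ s : List ℕ,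
    Encodable.encode s < π j → baireCylinder (s ++ (e j).2) ⊆ O M k}
  have hι : #(Finset 𝒮 × ℕ) < Cardinal.continuum := by
    rw [mk_prod, lift_id, lift_id, mk_nat]
    exact mul_lt_of_lt aleph0_le_continuum (mk_finset_lt_continuum hcard) aleph0_lt_continuum
  obtain ⟨V, hV, hYV⟩ := hsel hι Y
    (by
      rintro ⟨a, n⟩
      have hfin : {s : List ℕ | Encodable.encode s < n}.Finite :=
        (Set.finite_Iio n).preimage Encodable.encode_injective.injOn
      let G : Set (ℕ → ℕ) := ⋂ q ∈ a ×ˢ Finset.range n, O q.1 q.2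
      have hGo : IsOpen G := isOpen_biInter_finset fun q _ => hOo _ _
      have hGd : Dense G := dense_biInter_of_isOpen (fun q _ => hOo _ _)
        (a ×ˢ Finset.range n).countable_toSet fun q _ => hOd _ _
      obtain ⟨t, ht⟩ := exists_forall_baireCylinder_append_subset hGo hGd hfin.toFinset
      refine ⟨e.symm (n, t), ?_⟩
      simp only [Y, π, Set.mem_ofPred_eq, Equiv.apply_symm_apply, le_refl, true_and]
      intro M hM k hk s hs
      exact (ht s (by simpa using hs)).trans
        (Set.biInter_subset_of_mem (t := fun q : 𝒮 × ℕ => O q.1 q.2) (x := (M, k))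
          (Finset.mem_coe.2 (Finset.mem_product.2 ⟨hM, Finset.mem_range.2 hk⟩))))
    (by
      rintro ⟨a, m⟩ ⟨b, n⟩
      refine ⟨(a ∪ b, max m n), fun j hj => ⟨⟨?_, ?_⟩, ?_, ?_⟩⟩
      · exact (le_max_left m n).trans hj.1
      · exact fun M hM => hj.2 M (Finset.mem_union_left _ hM)
      · exact (le_max_right m n).trans hj.1
      · exact fun M hM => hj.2 M (Finset.mem_union_right _ hM))
  obtain ⟨hVempty, -, -, hVinter⟩ := hV.1.1
  have hbdd : ∀ A n, (∀ j ∈ A, π j < n) → A ∉ V := by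
    intro A n hA hAV
    refine hVempty ?_
    convert hVinter _ hAV _ (hYV (∅, n))
    symm
    rw [Set.eq_empty_iff_forall_notMem]
    exact fun j hj => absurd (hA j hj.1) (not_lt.2 hj.2.1)
  obtain ⟨S, hSV, hS⟩ := hV.exists_selector π fun k => hbdd _ (k + 1) fun j hj => by
    rw [Set.mem_ofPred_eq] at hj
    lia
  let t : ℕ → List ℕ := fun n => if h : ∃ j ∈ S, π j = n then (e h.choose).2 else []
  have ht : ∀ j ∈ S, t (π j) = (e j).2 := by
    intro j hj
    have h : ∃ i ∈ S, π i = π j := ⟨j, hj, rfl⟩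
    have h' : h.choose = j := hS h.choose_spec.1 hj h.choose_spec.2
    simp only [t, dif_pos h, h']
  let c : ℕ → ℕ := fun n => (subConcats t (n + 1)).sup Encodable.encode
  have hc : Monotone c := monotone_nat_of_le_succ fun n => Finset.sup_mono Finset.subset_union_left
  obtain ⟨m, κ, hm, hκ, hcκ⟩ := exists_interval_labelling c hc
  obtain ⟨T, hTV, hT⟩ := hV.exists_selector (fun j => κ (π j)) fun k => hbdd _ (m k) fun j hj => by
    rw [← show κ (π j) = k from hj]
    exact hm _
  obtain ⟨r, hr⟩ : ∃ r, {j | κ (π j) % 2 = r} ∈ V := by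
    rcases hV.1.2 {j | κ (π j) % 2 = 0} with h | h
    · exact ⟨0, h⟩
    · refine ⟨1, ?_⟩
      convert h using 1
      ext j
      simp
  let W := S ∩ (T ∩ {j | κ (π j) % 2 = r})
  have hWV : W ∈ V := hVinter _ hSV _ (hVinter _ hTV _ hr)
  let L := concatOn t (π '' W)
  have hL : ∀ n ∈ π '' W, 0 < n → Encodable.encode (L n) < n := by
    rintro _ ⟨j, hj, rfl⟩ hpos
    rcases concatOn_eq_nil_or t (π '' W) (π j) with h | ⟨_, ⟨i, hi, rfl⟩, hlt, h⟩
    · simpa [L, h] using hpos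
    · refine lt_of_le_of_lt ?_ (hcκ (π i) (π j) ?_)
      · simp only [L, h, c]
        exact Finset.le_sup (concatOn_mem_subConcats t _ _)
      · have h1 := hκ hlt.le
        have h2 : κ (π i) ≠ κ (π j) := fun h => hlt.ne (congrArg π (hT hi.2.1 hj.2.1 h))
        have h3 : κ (π i) % 2 = r := hi.2.2
        have h4 : κ (π j) % 2 = r := hj.2.2
        lia
  obtain ⟨x, hx⟩ := exists_mem_iInter_baireCylinder (concatOn_prefix_succ t (π '' W))
  obtain ⟨M, hM, hxM⟩ : x ∈ ⋃₀ 𝒮 := hcover ▸ Set.mem_univ x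
  obtain ⟨k, hk⟩ := hOM ⟨M, hM⟩ x hxM
  obtain ⟨j, hjW, hjk, hjY⟩ : (W ∩ Y ({⟨M, hM⟩}, k + 1)).Nonempty := by
    rw [Set.nonempty_iff_ne_empty]
    exact fun h => hVempty (h ▸ hVinter _ hWV _ (hYV _))
  have hjk' : k + 1 ≤ π j := hjk
  refine hk (hjY _ (Finset.mem_singleton_self _) k (by lia) (L (π j))
    (hL _ ⟨j, hjW, rfl⟩ (by lia)) ?_)
  have := hx (π j + 1)
  rwa [concatOn_succ_of_mem t (Set.mem_image_of_mem π hjW), ht j hjW.1] at this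

/-- Generic existence of coherent selective ultrafilters on a complete ccc
algebra of size at most 𝔠 is equivalent to the statement that fewer than 𝔠
meager sets cannot cover the Baire space (i.e. to 𝔠 = cov(ℳ)). -/
theorem coherentSelective_generic_existence_iff_covM
    [CompleteBooleanAlgebra B] [Infinite B] (hcc : BCCC B)
    (hcard : #B ≤ Cardinal.continuum) :
    (∀ F : Set B, IsBFilter F →
        (∃ C ⊆ F, #C < Cardinal.continuum ∧ ∀ a ∈ F, ∃ c ∈ C, c ≤ a) →
        ∃ U : Set B, IsCoherentSelectiveUltrafilter U ∧ F ⊆ U) ↔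
    ¬∃ 𝒮 : Set (Set (ℕ → ℕ)), #𝒮 < Cardinal.continuum ∧
        (∀ s ∈ 𝒮, IsMeagre s) ∧ ⋃₀ 𝒮 = Set.univ := by
  refine ⟨fun hgen => not_meagre_cover_of_exists_selective
    fun hι _ Y hne hdir => exists_selective_of_generic_existence hgen hι Y hne hdir, ?_⟩
  rintro hcov F hF ⟨C, hCF, hCc, hC⟩
  obtain ⟨U, hU, hCU⟩ := exists_coherentSelective_of_not_meagre_cover hcard hcov
    (fun s hs h => hF.1 (h ▸ hF.inf_mem s (hs.trans hCF))) hCc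
  refine ⟨U, hU, fun a ha => ?_⟩
  obtain ⟨c, hc, hca⟩ := hC a ha
  exact hU.1.1.2.2.1 c (hCU hc) a hca
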